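/- arXiv:2410.13451 — 2 statements merged into one kernel-verified Lean document; each statement's English description precedes it below -/
import Mathlib

section
/- Let G = (V, E) be a finite simple graph, let 0 < φ ≤ 1, and let A ⊆ V be such that G[A] is a φ-nearly expander in G. Suppose there exists a feasible flow f supported on the edges of G[A], with every edge of G[A] given capacity 2/φ, that routes the source function Δ(v) = (2/φ)·(deg_G(v) − deg_{G[A]}(v)) into sinks of capacity ∇(v) = deg_G(v) for all v ∈ A (i.e., for every v ∈ A the net flow out of v equals Δ(v) minus an absorbed amount lying in [0, ∇(v)], and |f(e)| ≤ 2/φ on every edge). Then G[A] is a (φ/6)-expander. -/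
open Finset

variable {V : Type}

/-- The volume `deg_G(S) = ∑_{v ∈ S} deg_G(v)` of a vertex set. -/
def degSum (G : SimpleGraph V) [Fintype V] [DecidableRel G.Adj] (S : Finset V) : ℕ :=
  ∑ v ∈ S, G.degree v

/-- The number of edges of `G` between the disjoint sets `S` and `T`
(counted as ordered pairs `(s, t)` with `s ∈ S`, `t ∈ T`, `s ~ t`). -/
def interEdges (G : SimpleGraph V) [Fintype V] [DecidableEq V] [DecidableRel G.Adj]
    (S T : Finset V) : ℕ :=
  ((S ×ˢ T).filter fun p => G.Adj p.1 p.2).card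

/-- The degree of `v` in the induced subgraph `G[A]`. -/
def indDeg (G : SimpleGraph V) [DecidableEq V] [DecidableRel G.Adj]
    (A : Finset V) (v : V) : ℕ :=
  (A.filter fun u => G.Adj v u).card

/-- The volume of `S` in the induced subgraph `G[A]`. -/
def indDegSum (G : SimpleGraph V) [DecidableEq V] [DecidableRel G.Adj]
    (A S : Finset V) : ℕ :=
  ∑ v ∈ S, indDeg G A v

/-- The induced subgraph `G[A]` is a `φ`-expander. -/
def IsExpanderOn (G : SimpleGraph V) [Fintype V] [DecidableEq V] [DecidableRel G.Adj]
    (A : Finset V) (φ : ℝ) : Prop :=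
  ∀ S ⊆ A,
    φ * min (indDegSum G A S : ℝ) (indDegSum G A (A \ S)) ≤ interEdges G S (A \ S)

/-- `G[A]` is a `φ`-nearly expander in `G`. -/
def IsNearlyExpanderIn (G : SimpleGraph V) [Fintype V] [DecidableEq V] [DecidableRel G.Adj]
    (A : Finset V) (φ : ℝ) : Prop :=
  ∀ S ⊆ A, (degSum G S : ℝ) ≤ degSum G (A \ S) →
    φ * degSum G S ≤ interEdges G S (Finset.univ \ S)

theorem interEdges_eq (G : SimpleGraph V) [Fintype V] [DecidableEq V] [DecidableRel G.Adj]
    (S T : Finset V) :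
    (interEdges G S T : ℝ) = ∑ v ∈ S, ∑ u ∈ T, if G.Adj v u then (1 : ℝ) else 0 := by
  rw [← Finset.sum_product' S T (fun v u => if G.Adj v u then (1 : ℝ) else 0)]
  simp [interEdges]

theorem indDeg_eq (G : SimpleGraph V) [DecidableEq V] [DecidableRel G.Adj]
    (A : Finset V) (v : V) :
    (indDeg G A v : ℝ) = ∑ u ∈ A, if G.Adj v u then (1 : ℝ) else 0 := by
  simp [indDeg]

theorem degree_eq_sum (G : SimpleGraph V) [Fintype V] [DecidableEq V] [DecidableRel G.Adj]
    (v : V) : (G.degree v : ℝ) = ∑ u, if G.Adj v u then (1 : ℝ) else 0 := by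
  rw [← SimpleGraph.card_neighborFinset_eq_degree, SimpleGraph.neighborFinset_eq_filter]
  simp

theorem interEdges_symm (G : SimpleGraph V) [Fintype V] [DecidableEq V] [DecidableRel G.Adj]
    (S T : Finset V) : (interEdges G S T : ℝ) = interEdges G T S := by
  rw [interEdges_eq, interEdges_eq, Finset.sum_comm]
  simp only [G.adj_comm]

theorem indDegSum_le (G : SimpleGraph V) [Fintype V] [DecidableEq V] [DecidableRel G.Adj]
    (A S : Finset V) : (indDegSum G A S : ℝ) ≤ degSum G S := by
  unfold indDegSum degSum
  push_cast
  refine Finset.sum_le_sum fun v _ => ?_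
  rw [indDeg_eq, degree_eq_sum]
  exact Finset.sum_le_sum_of_subset_of_nonneg (Finset.subset_univ _)
    (fun _ _ _ => by split_ifs <;> norm_num)

theorem flow_core (G : SimpleGraph V) [Fintype V] [DecidableEq V]
    [DecidableRel G.Adj] (φ : ℝ) (A : Finset V) (hφ0 : 0 < φ)
    (hA : IsNearlyExpanderIn G A φ)
    (f : V → V → ℝ)
    (hanti : ∀ u v, f u v = - f v u)
    (hsupp : ∀ u v, f u v ≠ 0 → G.Adj u v ∧ u ∈ A ∧ v ∈ A)
    (hcap : ∀ u v, |f u v| ≤ 2 / φ)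
    (hroute : ∀ v ∈ A,
      2 / φ * ((G.degree v : ℝ) - indDeg G A v) + ∑ u, f u v ≤ G.degree v)
    (S : Finset V) (hS : S ⊆ A) (hd : (degSum G S : ℝ) ≤ degSum G (A \ S)) :
    φ / 4 * degSum G S ≤ interEdges G S (A \ S) := by
  have h1 := hA S hS hd
  set y : ℝ := ∑ v ∈ S, ((G.degree v : ℝ) - indDeg G A v) with hy
  have hxy : (interEdges G S (Finset.univ \ S) : ℝ) = interEdges G S (A \ S) + y := by
    rw [interEdges_eq, interEdges_eq, hy, ← Finset.sum_add_distrib]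
    refine Finset.sum_congr rfl fun v _ => ?_
    rw [degree_eq_sum, indDeg_eq,
      ← Finset.sum_sdiff (Finset.subset_univ S), ← Finset.sum_sdiff hS]
    ring
  have h0 : ∑ v ∈ S, ∑ u ∈ S, f u v = 0 := by
    have : ∑ v ∈ S, ∑ u ∈ S, f u v = - ∑ v ∈ S, ∑ u ∈ S, f u v := by
      conv_lhs => rw [Finset.sum_comm]
      rw [← Finset.sum_neg_distrib]
      refine Finset.sum_congr rfl fun v _ => ?_
      rw [← Finset.sum_neg_distrib]
      exact Finset.sum_congr rfl fun u _ => hanti _ _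
    linarith
  have hflow : -(2 / φ * interEdges G S (A \ S)) ≤ ∑ v ∈ S, ∑ u, f u v := by
    have e : ∑ v ∈ S, ∑ u, f u v = ∑ v ∈ S, ∑ u ∈ A \ S, f u v := by
      have : ∀ v ∈ S, ∑ u, f u v = ∑ u ∈ A \ S, f u v + ∑ u ∈ S, f u v := by
        intro v _
        rw [Finset.sum_sdiff hS]
        symm
        apply Finset.sum_subset (Finset.subset_univ _)
        intro u _ hu
        by_contra hne
        exact hu (hsupp u v hne).2.1
      rw [Finset.sum_congr rfl this, Finset.sum_add_distrib, h0, add_zero]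
    rw [e, interEdges_eq, Finset.mul_sum, ← Finset.sum_neg_distrib]
    refine Finset.sum_le_sum fun v _ => ?_
    rw [Finset.mul_sum, ← Finset.sum_neg_distrib]
    refine Finset.sum_le_sum fun u _ => ?_
    split_ifs with hadj
    · rw [mul_one]
      exact (abs_le.mp (hcap u v)).1
    · have : f u v = 0 := by
        by_contra hne
        exact hadj (hsupp u v hne).1.symm
      simp [this]
  have hsum : 2 / φ * y + ∑ v ∈ S, ∑ u, f u v ≤ degSum G S := by
    unfold degSum
    push_cast
    rw [hy, Finset.mul_sum, ← Finset.sum_add_distrib]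
    exact Finset.sum_le_sum fun v hv => hroute v (hS hv)
  rw [hxy] at h1
  have h3 : 2 / φ * (y - interEdges G S (A \ S)) ≤ degSum G S := by linarith
  have h4 : φ * (2 / φ * (y - interEdges G S (A \ S))) ≤ φ * degSum G S :=
    mul_le_mul_of_nonneg_left h3 hφ0.le
  have h5 : φ * (2 / φ * (y - interEdges G S (A \ S))) = 2 * (y - interEdges G S (A \ S)) := by
    field_simp
  linarith

/-- **Flow certificate for expansion** (Lemma 3.2): if `G[A]` is a `φ`-nearly expander
in `G` and a feasible flow supported on `G[A]` with edge capacities `2/φ` routes the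
source `Δ(v) = (2/φ)·(deg_G(v) − deg_{G[A]}(v))` into sinks `∇(v) = deg_G(v)`, then
`G[A]` is a `φ/6`-expander. -/
theorem flow_certificate (G : SimpleGraph V) [Fintype V] [DecidableEq V]
    [DecidableRel G.Adj] (φ : ℝ) (A : Finset V) (hφ0 : 0 < φ) (hφ1 : φ ≤ 1)
    (hA : IsNearlyExpanderIn G A φ)
    (f : V → V → ℝ)
    (hanti : ∀ u v, f u v = - f v u)
    (hsupp : ∀ u v, f u v ≠ 0 → G.Adj u v ∧ u ∈ A ∧ v ∈ A)
    (hcap : ∀ u v, |f u v| ≤ 2 / φ)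
    (hroute : ∀ v ∈ A,
      0 ≤ 2 / φ * ((G.degree v : ℝ) - indDeg G A v) + ∑ u, f u v ∧
      2 / φ * ((G.degree v : ℝ) - indDeg G A v) + ∑ u, f u v ≤ G.degree v) :
    IsExpanderOn G A (φ / 6) := by
  intro S hS
  have hr : ∀ v ∈ A,
      2 / φ * ((G.degree v : ℝ) - indDeg G A v) + ∑ u, f u v ≤ G.degree v :=
    fun v hv => (hroute v hv).2
  have key : ∀ T : Finset V, φ / 4 * degSum G T ≤ interEdges G S (A \ S) →
      φ / 6 * (indDegSum G A T : ℝ) ≤ interEdges G S (A \ S) := by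
    intro T hT
    have h1 := indDegSum_le G A T
    have h2 : φ / 6 * (indDegSum G A T : ℝ) ≤ φ / 6 * degSum G T :=
      mul_le_mul_of_nonneg_left h1 (by positivity)
    have h3 : 0 ≤ φ * (degSum G T : ℝ) := by positivity
    linarith
  rcases le_total (degSum G S : ℝ) (degSum G (A \ S)) with h | h
  · exact (mul_le_mul_of_nonneg_left (min_le_left _ _) (by positivity)).trans
      (key S (flow_core G φ A hφ0 hA f hanti hsupp hcap hr S hS h))
  · have hss : A \ (A \ S) = S := Finset.sdiff_sdiff_eq_self hS
    have hc := flow_core G φ A hφ0 hA f hanti hsupp hcap hr (A \ S) Finset.sdiff_subset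
      (by rw [hss]; exact h)
    rw [hss, interEdges_symm] at hc
    exact (mul_le_mul_of_nonneg_left (min_le_right _ _) (by positivity)).trans (key _ hc)
end

section
/- Let G = (V, E) be a finite simple graph, let 0 < φ ≤ 1, and let A ⊆ V be such that G[A] is a φ-nearly expander in G. Let S ⊆ A satisfy deg_G(S) ≤ deg_G(A∖S) and |E_{G[A]}(S, A∖S)| < (φ/6)·deg_G(S). Then Σ_{v∈S} (2/φ)·(deg_G(v) − deg_{G[A]}(v)) ≥ (5/3)·deg_G(S). -/
open Finset

variable {V : Type}

theorem interEdges_eq_sum (G : SimpleGraph V) [Fintype V] [DecidableEq V]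
    [DecidableRel G.Adj] (S T : Finset V) :
    interEdges G S T = ∑ v ∈ S, indDeg G T v := by
  unfold interEdges indDeg
  simp only [Finset.card_filter]
  rw [Finset.sum_product]

theorem indDeg_union (G : SimpleGraph V) [DecidableEq V] [DecidableRel G.Adj]
    (A B : Finset V) (h : Disjoint A B) (v : V) :
    indDeg G (A ∪ B) v = indDeg G A v + indDeg G B v := by
  unfold indDeg
  simp only [Finset.card_filter]
  rw [Finset.sum_union h]

theorem indDeg_univ (G : SimpleGraph V) [Fintype V] [DecidableEq V] [DecidableRel G.Adj]
    (v : V) : indDeg G Finset.univ v = G.degree v := by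
  unfold indDeg
  rw [← SimpleGraph.card_neighborFinset_eq_degree, SimpleGraph.neighborFinset_eq_filter]

/-- The source-mass lower bound from the proof of Lemma 3.2: if `G[A]` is a `φ`-nearly
expander, `S ⊆ A`, `deg_G(S) ≤ deg_G(A∖S)` and `|E_{G[A]}(S, A∖S)| < (φ/6)·deg_G(S)`,
then `Σ_{v∈S} (2/φ)·(deg_G(v) − deg_{G[A]}(v)) ≥ (5/3)·deg_G(S)`. -/
theorem source_mass_lower_bound (G : SimpleGraph V) [Fintype V] [DecidableEq V]
    [DecidableRel G.Adj] (φ : ℝ) (A S : Finset V) (hφ0 : 0 < φ) (hφ1 : φ ≤ 1)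
    (hA : IsNearlyExpanderIn G A φ) (hSA : S ⊆ A)
    (hdeg : (degSum G S : ℝ) ≤ degSum G (A \ S))
    (hsparse : (interEdges G S (A \ S) : ℝ) < φ / 6 * degSum G S) :
    5 / 3 * (degSum G S : ℝ) ≤ ∑ v ∈ S, 2 / φ * ((G.degree v : ℝ) - indDeg G A v) := by
  have h1 : ∀ v, (G.degree v : ℝ) - indDeg G A v = indDeg G (Finset.univ \ A) v := by
    intro v
    have := indDeg_union G A (Finset.univ \ A) Finset.disjoint_sdiff v
    rw [Finset.union_sdiff_of_subset (Finset.subset_univ A), indDeg_univ] at this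
    rw [this]; push_cast; ring
  have h2 : interEdges G S (Finset.univ \ S)
      = interEdges G S (A \ S) + interEdges G S (Finset.univ \ A) := by
    have hd : Disjoint (A \ S) (Finset.univ \ A) :=
      Finset.disjoint_of_subset_left Finset.sdiff_subset Finset.disjoint_sdiff
    have hu : Finset.univ \ S = (A \ S) ∪ (Finset.univ \ A) := by
      ext x
      have := @hSA x
      simp only [Finset.mem_sdiff, Finset.mem_union, Finset.mem_univ, true_and]
      tauto
    rw [hu]
    simp only [interEdges_eq_sum, indDeg_union G _ _ hd, Finset.sum_add_distrib]
  have h3 := hA S hSA hdeg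
  rw [h2] at h3
  push_cast at h3
  simp only [h1]
  rw [← Finset.mul_sum, ← Nat.cast_sum, ← interEdges_eq_sum]
  rw [div_mul_eq_mul_div 2 φ, le_div_iff₀ hφ0]
  linarith
end
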